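/- Let R = ℂ[x,y,z,w], let J = (x·z − y², x·w − y·z, y·w − z²) be the homogeneous ideal of the standard twisted cubic curve C ⊂ P³, let ℓ be a linear form and q a quadratic form such that ℓ, q is a regular sequence, let I = (ℓ, q) (the homogeneous ideal of a conic Q), and suppose that (x,y,z,w)^N ⊆ I + J for some natural number N (i.e., Q ∩ C = ∅). Then dim_ℂ ((I ∩ J) ∩ R₃) = 3 and dim_ℂ ((I ∩ J) ∩ R₄) = 13. (These are the computations h⁰(I_Y(3)) = 3 and h⁰(I_Y(4)) = 13 for Y = Q ∪ C.) -/

import Mathlib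

open MvPolynomial

section Homogeneous

variable {σ K : Type*} [Field K]

/-- Multiplying by a homogeneous polynomial of degree `m` shifts homogeneous components by `m`. -/
lemma homogeneousComponent_homogeneous_mul {f : MvPolynomial σ K} {m : ℕ}
    (hf : f.IsHomogeneous m) (d : ℕ) (p : MvPolynomial σ K) :
    homogeneousComponent (m + d) (f * p) = f * homogeneousComponent d p := by
  let := gradedAlgebra (σ := σ) (R := K)
  have hcomp (k : ℕ) (u : MvPolynomial σ K) :
      (DirectSum.decompose (homogeneousSubmodule σ K) u k : MvPolynomial σ K) =
        homogeneousComponent k u :=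
    decomposition.decompose'_apply u k
  rw [← hcomp, ← hcomp]
  exact DirectSum.coe_decompose_mul_add_of_left_mem (homogeneousSubmodule σ K) hf

lemma isHomogeneous_of_mul_left {f p : MvPolynomial σ K} {m d : ℕ} (hf : f.IsHomogeneous m)
    (hf0 : f ≠ 0) (hfp : (f * p).IsHomogeneous (m + d)) : p.IsHomogeneous d := by
  have h := homogeneousComponent_homogeneous_mul hf d p
  rw [homogeneousComponent_eq_self hfp] at h
  rw [mul_left_cancel₀ hf0 h]
  exact homogeneousComponent_isHomogeneous d p

lemma not_isUnit_of_isHomogeneous {f : MvPolynomial σ K} {m : ℕ} (hf : f.IsHomogeneous m)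
    (hm : m ≠ 0) : ¬ IsUnit f := by
  intro h
  have h0 : constantCoeff f = 0 := hf.coeff_eq_zero (by simpa using hm.symm)
  exact (h.map constantCoeff).ne_zero h0

instance finite_homogeneousSubmodule [Finite σ] (n : ℕ) :
    Module.Finite K (homogeneousSubmodule σ K n) :=
  Module.Finite.iff_fg.mpr (homogeneousSubmodule_fg σ K n)

lemma finrank_homogeneousSubmodule [Fintype σ] (n : ℕ) :
    Module.finrank K (homogeneousSubmodule σ K n) = (Fintype.card σ + n - 1).choose n := by
  classical
  have hset : {d : σ →₀ ℕ | d.degree = n} = (Finset.univ.finsuppAntidiag n : Finset (σ →₀ ℕ)) := by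
    ext d
    simp [Finsupp.degree_eq_sum]
  rw [homogeneousSubmodule_eq_finsupp_supported, hset,
    (AddMonoidAlgebra.supportedEquivFinsupp _).finrank_eq]
  simp [Finset.card_finsuppAntidiag_nat_eq_choose]

/-- The degree `t` part of the ideal `(f, g)`, for `f` and `g` homogeneous. -/
lemma span_pair_inf_homogeneousSubmodule {f g : MvPolynomial σ K} {m n a b t : ℕ}
    (hf : f.IsHomogeneous m) (hg : g.IsHomogeneous n) (ha : m + a = t) (hb : n + b = t) :
    Submodule.restrictScalars K (Ideal.span {f, g}) ⊓ homogeneousSubmodule σ K t =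
      (homogeneousSubmodule σ K a).map (LinearMap.mulLeft K f) ⊔
        (homogeneousSubmodule σ K b).map (LinearMap.mulLeft K g) := by
  apply le_antisymm
  · rintro p ⟨hp, hpt⟩
    obtain ⟨u, v, rfl⟩ := Ideal.mem_span_pair.mp hp
    rw [← homogeneousComponent_eq_self hpt, map_add, mul_comm u, mul_comm v]
    nth_rewrite 1 [← ha]
    rw [← hb, homogeneousComponent_homogeneous_mul hf, homogeneousComponent_homogeneous_mul hg]
    exact Submodule.add_mem_sup
      (Submodule.mem_map_of_mem (f := LinearMap.mulLeft K f) (homogeneousComponent_mem _ _))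
      (Submodule.mem_map_of_mem (f := LinearMap.mulLeft K g) (homogeneousComponent_mem _ _))
  · refine sup_le ?_ ?_ <;> rintro _ ⟨u, hu, rfl⟩
    · exact ⟨Ideal.mul_mem_right _ _ (Ideal.subset_span (by simp)), ha ▸ hf.mul hu⟩
    · exact ⟨Ideal.mul_mem_right _ _ (Ideal.subset_span (by simp)), hb ▸ hg.mul hu⟩

lemma finrank_map_mulLeft {f : MvPolynomial σ K} (hf0 : f ≠ 0)
    (V : Submodule K (MvPolynomial σ K)) :
    Module.finrank K (V.map (LinearMap.mulLeft K f)) = Module.finrank K V :=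
  (Submodule.equivMapOfInjective _ (mul_right_injective₀ hf0) V).finrank_eq.symm

/-- The dimension count of the Koszul complex of a regular sequence of two forms. -/
lemma finrank_span_pair_inf_homogeneousSubmodule [Finite σ] {f g : MvPolynomial σ K} {m n : ℕ}
    (hf : f.IsHomogeneous m) (hg : g.IsHomogeneous n) (hf0 : f ≠ 0) (hm : m ≠ 0)
    (hreg : ∀ p, f ∣ g * p → f ∣ p) (d : ℕ) :
    Module.finrank K ↥(Submodule.restrictScalars K (Ideal.span {f, g}) ⊓
        homogeneousSubmodule σ K (m + n + d)) + Module.finrank K (homogeneousSubmodule σ K d) =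
      Module.finrank K (homogeneousSubmodule σ K (n + d)) +
        Module.finrank K (homogeneousSubmodule σ K (m + d)) := by
  have hg0 : g ≠ 0 := by
    rintro rfl
    exact not_isUnit_of_isHomogeneous hf hm (isUnit_of_dvd_one (hreg 1 (by simp)))
  have hinf : (homogeneousSubmodule σ K (n + d)).map (LinearMap.mulLeft K f) ⊓
      (homogeneousSubmodule σ K (m + d)).map (LinearMap.mulLeft K g) =
        (homogeneousSubmodule σ K d).map (LinearMap.mulLeft K (f * g)) := by
    apply le_antisymm
    · rintro _ ⟨⟨u, hu, rfl⟩, v, hv, huv⟩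
      simp only [LinearMap.mulLeft_apply] at huv ⊢
      obtain ⟨c, rfl⟩ := hreg v ⟨u, huv⟩
      refine ⟨c, isHomogeneous_of_mul_left hf hf0 hv, ?_⟩
      simp only [LinearMap.mulLeft_apply, ← huv]
      ring
    · rintro _ ⟨c, hc, rfl⟩
      refine ⟨⟨g * c, hg.mul hc, ?_⟩, f * c, hf.mul hc, ?_⟩ <;>
        simp only [LinearMap.mulLeft_apply] <;> ring
  rw [span_pair_inf_homogeneousSubmodule hf hg (a := n + d) (b := m + d) (by ring) (by ring),
    ← finrank_map_mulLeft (mul_ne_zero hf0 hg0) (homogeneousSubmodule σ K d), ← hinf,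
    Submodule.finrank_sup_add_finrank_inf_eq, finrank_map_mulLeft hf0, finrank_map_mulLeft hg0]

end Homogeneous

section TwistedCubic

/-- The ideal of the standard twisted cubic. -/
noncomputable def twistedCubicIdeal : Ideal (MvPolynomial (Fin 4) ℂ) :=
  Ideal.span {X 0 * X 2 - X 1 ^ 2, X 0 * X 3 - X 1 * X 2, X 1 * X 3 - X 2 ^ 2}

/-- The parametrization `(s³, s²t, st², t³)` of the twisted cubic, as a map of coordinate rings. -/
noncomputable def cubicParam : MvPolynomial (Fin 4) ℂ →ₐ[ℂ] MvPolynomial (Fin 2) ℂ :=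
  aeval ![X 0 ^ 3, X 0 ^ 2 * X 1, X 0 * X 1 ^ 2, X 1 ^ 3]

lemma isHomogeneous_cubicParam {p : MvPolynomial (Fin 4) ℂ} {d : ℕ} (hp : p.IsHomogeneous d) :
    (cubicParam p).IsHomogeneous (3 * d) := by
  refine hp.aeval _ fun i => ?_
  fin_cases i
  · exact isHomogeneous_X_pow 0 3
  · exact (isHomogeneous_X_pow 0 2).mul (isHomogeneous_X ℂ 1)
  · exact (isHomogeneous_X ℂ 0).mul (isHomogeneous_X_pow 1 2)
  · exact isHomogeneous_X_pow 1 3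

lemma cubicParam_X_add (i j k : Fin 2) :
    cubicParam (X ⟨i + j + k, by lia⟩) = X i * X j * X k := by
  fin_cases i <;> fin_cases j <;> fin_cases k <;> simp [cubicParam] <;> ring

lemma map_cubicParam_homogeneousSubmodule (d : ℕ) :
    (homogeneousSubmodule (Fin 4) ℂ d).map cubicParam.toLinearMap =
      homogeneousSubmodule (Fin 2) ℂ (3 * d) := by
  apply le_antisymm
  · rintro _ ⟨p, hp, rfl⟩
    exact isHomogeneous_cubicParam hp
  rw [← homogeneousSubmodule_one_pow _ d, ← homogeneousSubmodule_one_pow _ (3 * d), pow_mul,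
    Submodule.map_pow]
  gcongr
  rw [homogeneousSubmodule_one_eq_span_X, pow_succ, sq, Submodule.span_mul_span,
    Submodule.span_mul_span, Submodule.span_le]
  rintro _ ⟨_, ⟨_, ⟨i, rfl⟩, _, ⟨j, rfl⟩, rfl⟩, _, ⟨k, rfl⟩, rfl⟩
  exact ⟨X ⟨i + j + k, by lia⟩, isHomogeneous_X ℂ _, cubicParam_X_add i j k⟩

/-- Modulo the twisted cubic, every polynomial has the form `a + y b + z c` with
`a, b, c ∈ ℂ[x, w]`. -/
lemma exists_normalForm (p : MvPolynomial (Fin 4) ℂ) :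
    ∃ a b c : MvPolynomial (Fin 2) ℂ,
      p - (rename ![0, 3] a + X 1 * rename ![0, 3] b + X 2 * rename ![0, 3] c) ∈
        twistedCubicIdeal := by
  have h1 : (X 0 * X 2 - X 1 ^ 2 : MvPolynomial (Fin 4) ℂ) ∈ twistedCubicIdeal :=
    Ideal.subset_span (by simp)
  have h2 : (X 0 * X 3 - X 1 * X 2 : MvPolynomial (Fin 4) ℂ) ∈ twistedCubicIdeal :=
    Ideal.subset_span (by simp)
  have h3 : (X 1 * X 3 - X 2 ^ 2 : MvPolynomial (Fin 4) ℂ) ∈ twistedCubicIdeal :=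
    Ideal.subset_span (by simp)
  induction p using MvPolynomial.induction_on with
  | C r => exact ⟨C r, 0, 0, by simp⟩
  | add p p' hp hp' =>
    obtain ⟨a, b, c, h⟩ := hp
    obtain ⟨a', b', c', h'⟩ := hp'
    refine ⟨a + a', b + b', c + c', ?_⟩
    convert add_mem h h' using 1
    simp only [map_add]
    ring
  | mul_X p i hp =>
    obtain ⟨a, b, c, h⟩ := hp
    have hi := Ideal.mul_mem_right (X i) _ h
    fin_cases i
    · refine ⟨a * X 0, b * X 0, c * X 0, ?_⟩
      convert hi using 1
      simp
      ring
    · refine ⟨X 0 * X 1 * c, a, X 0 * b, ?_⟩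
      convert sub_mem hi (add_mem (Ideal.mul_mem_right (rename ![0, 3] b) _ h1)
        (Ideal.mul_mem_right (rename ![0, 3] c) _ h2)) using 1
      simp
      ring
    · refine ⟨X 0 * X 1 * b, X 1 * c, a, ?_⟩
      convert sub_mem hi (add_mem (Ideal.mul_mem_right (rename ![0, 3] b) _ h2)
        (Ideal.mul_mem_right (rename ![0, 3] c) _ h3)) using 1
      simp
      ring
    · refine ⟨a * X 1, b * X 1, c * X 1, ?_⟩
      convert hi using 1
      simp
      ring

lemma twistedCubicIdeal_le_ker : twistedCubicIdeal ≤ RingHom.ker cubicParam := by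
  refine Ideal.span_le.mpr ?_
  rintro _ (rfl | rfl | rfl) <;> simp [cubicParam] <;> ring

/-- The three residue classes of monomials `sⁱtʲ` with `3 ∣ i + j` are independent. -/
lemma eq_zero_of_expand_three_add_eq_zero {a b c : MvPolynomial (Fin 2) ℂ}
    (h : expand 3 a + X 0 ^ 2 * X 1 * expand 3 b + X 0 * X 1 ^ 2 * expand 3 c = 0) :
    a = 0 ∧ b = 0 ∧ c = 0 := by
  obtain ⟨ω, hω⟩ : ∃ ω : ℂ, IsPrimitiveRoot ω 3 :=
    ⟨_, Complex.isPrimitiveRoot_exp 3 (by norm_num)⟩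
  have hω3 : (C ω : MvPolynomial (Fin 2) ℂ) ^ 3 = 1 := by rw [← map_pow, hω.pow_eq_one, map_one]
  have hsum : 1 + C ω + C ω ^ 2 = (0 : MvPolynomial (Fin 2) ℂ) := by
    have := hω.geom_sum_eq_zero (by norm_num)
    simp only [Finset.sum_range_succ, Finset.sum_range_zero, pow_zero, pow_one, zero_add] at this
    simpa using congrArg (C : ℂ → MvPolynomial (Fin 2) ℂ) this
  let τ : MvPolynomial (Fin 2) ℂ →ₐ[ℂ] MvPolynomial (Fin 2) ℂ := aeval ![X 0, C ω * X 1]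
  have hτ (p : MvPolynomial (Fin 2) ℂ) : τ (expand 3 p) = expand 3 p := by
    have : τ.comp (expand 3) = expand 3 := by
      ext i : 1
      fin_cases i <;> simp [τ, mul_pow, hω3]
    exact DFunLike.congr_fun this p
  have hτ0 : τ (X 0) = X 0 := by simp [τ]
  have hτ1 : τ (X 1) = C ω * X 1 := by simp [τ]
  have hτC : τ (C ω) = C ω := by simp [τ]
  have h' := congrArg τ h
  simp only [map_add, map_mul, map_pow, hτ, hτ0, hτ1, map_zero] at h'
  have h'' := congrArg τ h'
  simp only [map_add, map_mul, map_pow, hτ, hτ0, hτ1, hτC, map_zero] at h''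
  have h3 : (3 : MvPolynomial (Fin 2) ℂ) ≠ 0 := by norm_num
  have hX (i : Fin 2) : (X i : MvPolynomial (Fin 2) ℂ) ≠ 0 := X_ne_zero i
  generalize C ω = o at *
  set A := expand 3 a
  set B := expand 3 b
  set D := expand 3 c
  have ha : A = 0 := by
    apply mul_left_cancel₀ h3
    linear_combination h + h' + h'' - (X 0 ^ 2 * X 1 * B + X 0 * X 1 ^ 2 * D) * hsum -
      o * (X 0 * X 1 ^ 2 * D) * hω3
  have hb : B = 0 := by
    apply mul_left_cancel₀ (mul_ne_zero h3 (mul_ne_zero (pow_ne_zero 2 (hX 0)) (hX 1)))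
    linear_combination h + o ^ 2 * h' + o * h'' - (A + X 0 * X 1 ^ 2 * D) * hsum -
      (2 * (X 0 ^ 2 * X 1 * B) + (o + o ^ 2) * (X 0 * X 1 ^ 2 * D)) * hω3
  have hc : D = 0 := by
    apply mul_left_cancel₀ (mul_ne_zero (hX 0) (pow_ne_zero 2 (hX 1)))
    linear_combination h - ha - X 0 ^ 2 * X 1 * hb
  exact ⟨(expand_eq_zero (by norm_num)).mp ha, (expand_eq_zero (by norm_num)).mp hb,
    (expand_eq_zero (by norm_num)).mp hc⟩

lemma ker_cubicParam : RingHom.ker cubicParam = twistedCubicIdeal := by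
  refine le_antisymm (fun p hp => ?_) twistedCubicIdeal_le_ker
  obtain ⟨a, b, c, h⟩ := exists_normalForm p
  have hrename (u : MvPolynomial (Fin 2) ℂ) : cubicParam (rename ![0, 3] u) = expand 3 u := by
    have : cubicParam.comp (rename ![0, 3]) = expand 3 := by
      ext i : 1
      fin_cases i <;> simp [cubicParam]
    exact DFunLike.congr_fun this u
  have h0 := twistedCubicIdeal_le_ker h
  rw [RingHom.mem_ker] at hp h0
  have hX1 : cubicParam (X 1) = X 0 ^ 2 * X 1 := by simp [cubicParam]
  have hX2 : cubicParam (X 2) = X 0 * X 1 ^ 2 := by simp [cubicParam]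
  simp only [map_sub, map_add, map_mul, hrename, hp, hX1, hX2, zero_sub, neg_eq_zero] at h0
  obtain ⟨rfl, rfl, rfl⟩ := eq_zero_of_expand_three_add_eq_zero h0
  simpa using h

end TwistedCubic

/-- If some power of the irrelevant ideal lies in `(l, q) + J`, then the restrictions of `l` and
`q` to the twisted cubic have no common factor. -/
lemma isRelPrime_cubicParam {l q : MvPolynomial (Fin 4) ℂ} {N : ℕ}
    (hN : (Ideal.span ({X 0, X 1, X 2, X 3} : Set (MvPolynomial (Fin 4) ℂ))) ^ N ≤
      Ideal.span {l, q} + twistedCubicIdeal) :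
    IsRelPrime (cubicParam l) (cubicParam q) := by
  intro u hul huq
  have hle : Ideal.span {l, q} + twistedCubicIdeal ≤ (Ideal.span {u}).comap cubicParam := by
    rw [Submodule.add_eq_sup]
    refine sup_le (Ideal.span_le.mpr ?_) fun p hp => ?_
    · rintro _ (rfl | rfl)
      · exact Ideal.mem_span_singleton.mpr hul
      · exact Ideal.mem_span_singleton.mpr huq
    · rw [Ideal.mem_comap, RingHom.mem_ker.mp (twistedCubicIdeal_le_ker hp)]
      exact zero_mem _
  have hX (i : Fin 4) (hi : X i ∈ ({X 0, X 1, X 2, X 3} : Set (MvPolynomial (Fin 4) ℂ))) :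
      u ∣ cubicParam (X i) ^ N := by
    have := hle (hN (Ideal.pow_mem_pow (Ideal.subset_span hi) N))
    rwa [Ideal.mem_comap, map_pow, Ideal.mem_span_singleton] at this
  have h0 := hX 0 (by simp)
  have h3 := hX 3 (by simp)
  simp only [cubicParam, aeval_X, Matrix.cons_val, ← pow_mul] at h0 h3
  have hX01 : IsRelPrime (X 0 : MvPolynomial (Fin 2) ℂ) (X 1) := by
    rw [(X_prime (i := (0 : Fin 2))).irreducible.isRelPrime_iff_not_dvd, X_dvd_X]
    simp
  exact hX01.pow h0 h3

/-- The Hilbert function of the ideal of the disjoint union of a conic and a twisted cubic. -/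
lemma finrank_conic_inf_twistedCubic {l q : MvPolynomial (Fin 4) ℂ}
    (hl : l.IsHomogeneous 1) (hq : q.IsHomogeneous 2) (hl0 : l ≠ 0)
    (hreg : ∀ p, l ∣ q * p → l ∣ p) (hrel : IsRelPrime (cubicParam l) (cubicParam q)) (d : ℕ)
    {t : ℕ} (ht : t = d + 3) :
    Module.finrank ℂ ↥(Submodule.restrictScalars ℂ (Ideal.span {l, q} ⊓ twistedCubicIdeal) ⊓
        homogeneousSubmodule (Fin 4) ℂ t) + (3 * d + 10) + (d + 3).choose 3 =
      (d + 5).choose 3 + (d + 4).choose 3 := by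
  subst ht
  have hfl := isHomogeneous_cubicParam hl
  have hfq := isHomogeneous_cubicParam hq
  have hfl0 : cubicParam l ≠ 0 := fun h => by
    rw [h, isRelPrime_zero_left] at hrel
    exact not_isUnit_of_isHomogeneous hfq (by norm_num) hrel
  set W := Submodule.restrictScalars ℂ (Ideal.span {l, q}) ⊓ homogeneousSubmodule (Fin 4) ℂ (d + 3)
    with hW
  have hdeg : 3 * 1 + 3 * 2 + 3 * d = 3 * (d + 3) := by ring
  have hfull : Submodule.restrictScalars ℂ (Ideal.span {cubicParam l, cubicParam q}) ⊓
      homogeneousSubmodule (Fin 2) ℂ (3 * (d + 3)) =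
        homogeneousSubmodule (Fin 2) ℂ (3 * (d + 3)) := by
    refine Submodule.eq_of_le_of_finrank_eq inf_le_right ?_
    have := finrank_span_pair_inf_homogeneousSubmodule hfl hfq hfl0 (by norm_num)
      (fun p => hrel.dvd_of_dvd_mul_left) (3 * d)
    rw [hdeg] at this
    simp only [finrank_homogeneousSubmodule, Fintype.card_fin] at this ⊢
    have hc (k : ℕ) : (2 + k - 1).choose k = k + 1 := by
      rw [show 2 + k - 1 = k + 1 by omega, Nat.choose_succ_self_right]
    simp only [hc] at this ⊢
    omega
  have hmap : W.map cubicParam.toLinearMap = homogeneousSubmodule (Fin 2) ℂ (3 * (d + 3)) := by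
    apply le_antisymm
    · rintro _ ⟨p, hp, rfl⟩
      exact isHomogeneous_cubicParam hp.2
    · rw [← hfull, span_pair_inf_homogeneousSubmodule hfl hfq (a := 3 * (d + 2)) (b := 3 * (d + 1))
        (by ring) (by ring), ← map_cubicParam_homogeneousSubmodule,
        ← map_cubicParam_homogeneousSubmodule, hW,
        span_pair_inf_homogeneousSubmodule hl hq (a := d + 2) (b := d + 1) (by ring) (by ring)]
      refine sup_le ?_ ?_
      · rintro _ ⟨_, ⟨p, hp, rfl⟩, rfl⟩
        exact ⟨l * p, Submodule.mem_sup_left ⟨p, hp, rfl⟩, map_mul cubicParam _ _⟩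
      · rintro _ ⟨_, ⟨p, hp, rfl⟩, rfl⟩
        exact ⟨q * p, Submodule.mem_sup_right ⟨p, hp, rfl⟩, map_mul cubicParam _ _⟩
  have hker : Submodule.restrictScalars ℂ (Ideal.span {l, q} ⊓ twistedCubicIdeal) ⊓
      homogeneousSubmodule (Fin 4) ℂ (d + 3) = W ⊓ LinearMap.ker cubicParam.toLinearMap := by
    ext p
    simp only [hW, ← ker_cubicParam, Submodule.mem_inf, Submodule.restrictScalars_mem,
      RingHom.mem_ker, LinearMap.mem_ker, AlgHom.toLinearMap_apply]
    tauto
  have hWdim := finrank_span_pair_inf_homogeneousSubmodule hl hq hl0 one_ne_zero hreg d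
  rw [show 1 + 2 + d = d + 3 by ring, ← hW] at hWdim
  have : Module.Finite ℂ W := Submodule.finiteDimensional_of_le inf_le_right
  have hrank := (cubicParam.toLinearMap.domRestrict W).finrank_range_add_finrank_ker
  rw [LinearMap.range_domRestrict, hmap, LinearMap.ker_domRestrict,
    ← Submodule.finrank_map_subtype_eq, Submodule.map_comap_subtype] at hrank
  rw [hker]
  have hc (k : ℕ) : (4 + k - 1).choose k = (k + 3).choose 3 := by
    rw [show 4 + k - 1 = k + 3 by omega, Nat.choose_symm_add]
  simp only [finrank_homogeneousSubmodule, Fintype.card_fin, hc] at hWdim hrank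
  have hc' : (2 + 3 * (d + 3) - 1).choose (3 * (d + 3)) = 3 * d + 10 := by
    rw [show 2 + 3 * (d + 3) - 1 = 3 * (d + 3) + 1 by omega, Nat.choose_succ_self_right]
    ring
  rw [hc'] at hrank
  rw [show 2 + d + 3 = d + 5 by ring, show 1 + d + 3 = d + 4 by ring] at hWdim
  omega

/-- Variables: `x = X 0`, `y = X 1`, `z = X 2`, `w = X 3` in `R = ℂ[x,y,z,w]`.
If `C` is the standard twisted cubic, with ideal `J`, and `Q` is a conic, with ideal
`I = (ℓ, q)` (`ℓ, q` a regular sequence), disjoint from `C`, then for `Y = Q ∪ C`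
one has `h⁰(I_Y(3)) = dim_ℂ ((I ∩ J) ∩ R₃) = 3` and
`h⁰(I_Y(4)) = dim_ℂ ((I ∩ J) ∩ R₄) = 13`. -/
theorem conic_union_twisted_cubic_cubics_and_quartics
    (l q : MvPolynomial (Fin 4) ℂ)
    (hl : l.IsHomogeneous 1) (hq : q.IsHomogeneous 2)
    (hreg : RingTheory.Sequence.IsRegular (MvPolynomial (Fin 4) ℂ) [l, q])
    (J : Ideal (MvPolynomial (Fin 4) ℂ))
    (hJ : J = Ideal.span {X 0 * X 2 - X 1 ^ 2, X 0 * X 3 - X 1 * X 2, X 1 * X 3 - X 2 ^ 2})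
    (I : Ideal (MvPolynomial (Fin 4) ℂ))
    (hI : I = Ideal.span {l, q})
    (hdisj : ∃ N : ℕ,
      (Ideal.span ({X 0, X 1, X 2, X 3} : Set (MvPolynomial (Fin 4) ℂ))) ^ N ≤ I + J) :
    Module.finrank ℂ
        ↥(Submodule.restrictScalars ℂ (I ⊓ J) ⊓
          MvPolynomial.homogeneousSubmodule (Fin 4) ℂ 3) = 3 ∧
    Module.finrank ℂ
        ↥(Submodule.restrictScalars ℂ (I ⊓ J) ⊓
          MvPolynomial.homogeneousSubmodule (Fin 4) ℂ 4) = 13 := by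
  obtain ⟨N, hN⟩ := hdisj
  obtain rfl : J = twistedCubicIdeal := hJ
  subst hI
  have hweak := hreg.toIsWeaklyRegular
  rw [RingTheory.Sequence.isWeaklyRegular_cons_iff,
    RingTheory.Sequence.isWeaklyRegular_singleton_iff] at hweak
  obtain ⟨hlreg, hqreg⟩ := hweak
  have hl0 : l ≠ 0 := by
    rintro rfl
    exact IsSMulRegular.not_zero hlreg
  have hdvd (p : MvPolynomial (Fin 4) ℂ) (hp : l ∣ q * p) : l ∣ p := by
    have := (isSMulRegular_quotient_iff_mem_of_smul_mem _ q).mp hqreg p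
    simp only [Submodule.mem_smul_pointwise_iff_exists, smul_eq_mul, Submodule.mem_top,
      true_and] at this
    obtain ⟨c, hc⟩ := hp
    obtain ⟨c', hc'⟩ := this ⟨c, hc.symm⟩
    exact ⟨c', hc'.symm⟩
  have hdim := finrank_conic_inf_twistedCubic hl hq hl0 hdvd (isRelPrime_cubicParam hN)
  have h3 : _ + 10 + 1 = 10 + 4 := hdim 0 (t := 3) rfl
  have h4 : _ + 13 + 4 = 20 + 10 := hdim 1 (t := 4) rfl
  exact ⟨by omega, by omega⟩
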